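/- Let S ⊂ V(G) be a subset of vertices such that every vertex v in bS is adjacent to at least K₀ ≥ 1 vertices of S, and suppose S ∪ bS = V(G). Then for every l ∈ ℕ with l ≥ 1, setting r = 2^l, and every f ∈ L₂(G): ‖f‖ ≤ 2r·(2·D₀/K₀ + 1)^{1/2} · (Σ_{u∈S} |f(u)|²)^{1/2} + (2^{4r−3}/K₀^{r/2}) · ‖L^{r/2} f‖, where D₀ = sup_{u∈S} d₀(u) and ‖L^{r/2} f‖ = ⟨L^r f, f⟩^{1/2}. -/

import Mathlib

open scoped BigOperators

variable {V : Type*}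

noncomputable def lapl (G : SimpleGraph V) [DecidableRel G.Adj] [G.LocallyFinite]
    (f : V → ℂ) (v : V) : ℂ :=
  ∑ u ∈ G.neighborFinset v, (f v - f u)

noncomputable def l2norm (f : V → ℂ) : ℝ :=
  Real.sqrt (∑' v, ‖f v‖ ^ 2)

/-- `⟨L^r f, f⟩`, the Dirichlet form of the `r`-th power of the Laplacian. -/
noncomputable def dirichletPow (G : SimpleGraph V) [DecidableRel G.Adj] [G.LocallyFinite]
    (f : V → ℂ) (r : ℕ) : ℝ :=
  (∑' v, (lapl G)^[r] f v * (starRingEnd ℂ) (f v)).re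

def bdry (G : SimpleGraph V) (S : Set V) : Set V :=
  {v | v ∉ S ∧ ∃ u ∈ S, G.Adj u v}

noncomputable def d0 (G : SimpleGraph V) (S : Set V) (u : V) : ℕ :=
  {w | w ∈ bdry G S ∧ G.Adj u w}.ncard

/-- `D₀ = sup_{u ∈ S} d₀(u)`. -/
noncomputable def D0 (G : SimpleGraph V) (S : Set V) : ℕ :=
  sSup (d0 G S '' S)

theorem d0_le_D0 (G : SimpleGraph V) [G.LocallyFinite] {D : ℕ} (hD : ∀ v, G.degree v ≤ D)
    (S : Set V) {u : V} (hu : u ∈ S) :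
    d0 G S u ≤ D0 G S := by
  refine le_csSup ⟨D, ?_⟩ ⟨u, hu, rfl⟩
  rintro _ ⟨w, -, rfl⟩
  refine le_trans ?_ (hD w)
  rw [← G.card_neighborFinset_eq_degree, ← Set.ncard_coe_finset]
  refine Set.ncard_le_ncard (fun x hx => ?_) (Finset.finite_toSet _)
  simpa using hx.2

section

variable (G : SimpleGraph V) [DecidableRel G.Adj] [G.LocallyFinite]

theorem summable_adj_fst {D : ℕ} (hD : ∀ v, G.degree v ≤ D) {g : V → ℝ}
    (hg : ∀ v, 0 ≤ g v) (hs : Summable g) :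
    Summable fun p : V × V => if G.Adj p.1 p.2 then g p.1 else 0 := by
  rw [summable_prod_of_nonneg (fun p => by dsimp; split_ifs <;> simp [hg])]
  constructor
  · intro v
    apply summable_of_ne_finset_zero (s := G.neighborFinset v)
    intro u hu
    simpa using fun h => absurd ((G.mem_neighborFinset v u).2 h) hu
  · refine Summable.of_nonneg_of_le (fun v => tsum_nonneg fun u => ?_) (fun v => ?_)
      (hs.mul_left (D : ℝ))
    · dsimp; split_ifs <;> simp [hg]
    · rw [tsum_eq_sum (s := G.neighborFinset v)
        (fun u hu => if_neg fun h => hu ((G.mem_neighborFinset v u).2 h))]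
      rw [Finset.sum_congr rfl (g := fun _ => g v)
        (fun u hu => if_pos ((G.mem_neighborFinset v u).1 hu)), Finset.sum_const, nsmul_eq_mul]
      have h : ((G.neighborFinset v).card : ℝ) ≤ D := by exact_mod_cast hD v
      exact mul_le_mul_of_nonneg_right h (hg v)

theorem summable_adj_snd {D : ℕ} (hD : ∀ v, G.degree v ≤ D) {g : V → ℝ}
    (hg : ∀ v, 0 ≤ g v) (hs : Summable g) :
    Summable fun p : V × V => if G.Adj p.1 p.2 then g p.2 else 0 := by
  refine ((Equiv.prodComm V V).summable_iff.2 (summable_adj_fst G hD hg hs)).congr fun p => ?_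
  simp [G.adj_comm]

/-- A kernel supported on edges and dominated by `g v + h u` is summable. -/
theorem summable_of_adj_bound {E : Type*} [NormedAddCommGroup E] [CompleteSpace E]
    {D : ℕ} (hD : ∀ v, G.degree v ≤ D) {g h : V → ℝ}
    (hg : ∀ v, 0 ≤ g v) (hgs : Summable g) (hh : ∀ v, 0 ≤ h v) (hhs : Summable h)
    {F : V × V → E} (hF0 : ∀ p, ¬ G.Adj p.1 p.2 → F p = 0)
    (hF : ∀ p, ‖F p‖ ≤ g p.1 + h p.2) : Summable F := by
  refine Summable.of_norm_bounded
    ((summable_adj_fst G hD hg hgs).add (summable_adj_snd G hD hh hhs)) fun p => ?_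
  by_cases hp : G.Adj p.1 p.2
  · simpa [hp] using hF p
  · simp [hp, hF0 p hp]

theorem norm_sub_mul_conj_le (a b c : ℂ) :
    ‖(a - b) * (starRingEnd ℂ) c‖ ≤ (‖a‖ ^ 2 + ‖c‖ ^ 2) + ‖b‖ ^ 2 := by
  rw [norm_mul, RCLike.norm_conj]
  have h1 := norm_sub_le a b
  have h2 := mul_le_mul_of_nonneg_right h1 (norm_nonneg c)
  nlinarith [sq_nonneg (‖a‖ - ‖c‖), sq_nonneg (‖b‖ - ‖c‖), sq_nonneg ‖a‖, sq_nonneg ‖b‖]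

theorem norm_sub_sq_le (a b : ℂ) : ‖a - b‖ ^ 2 ≤ 2 * ‖a‖ ^ 2 + 2 * ‖b‖ ^ 2 := by
  have h1 := norm_sub_le a b
  nlinarith [sq_nonneg (‖a‖ - ‖b‖), norm_nonneg (a - b), norm_nonneg a, norm_nonneg b]

theorem summable_norm_sub_sq {D : ℕ} (hD : ∀ v, G.degree v ≤ D) {f : V → ℂ}
    (hf : Summable fun v => ‖f v‖ ^ 2) :
    Summable fun p : V × V => if G.Adj p.1 p.2 then ‖f p.1 - f p.2‖ ^ 2 else 0 := by
  refine summable_of_adj_bound G hD (g := fun v => 2 * ‖f v‖ ^ 2) (h := fun v => 2 * ‖f v‖ ^ 2)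
    (fun v => by positivity) (hf.mul_left 2) (fun v => by positivity) (hf.mul_left 2)
    (fun p hp => if_neg hp) fun p => ?_
  split_ifs
  · rw [Real.norm_of_nonneg (by positivity)]
    exact norm_sub_sq_le _ _
  · rw [norm_zero]; positivity

theorem tsum_adj_eq_sum {E : Type*} [NormedAddCommGroup E] (v : V) (F : V → E) :
    ∑' u, (if G.Adj v u then F u else 0) = ∑ u ∈ G.neighborFinset v, F u := by
  rw [tsum_eq_sum (s := G.neighborFinset v)
    (fun u hu => if_neg fun h => hu ((G.mem_neighborFinset v u).2 h))]
  exact Finset.sum_congr rfl fun u hu => if_pos ((G.mem_neighborFinset v u).1 hu)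

theorem summable_lapl {D : ℕ} (hD : ∀ v, G.degree v ≤ D) {f : V → ℂ}
    (hf : Summable fun v => ‖f v‖ ^ 2) : Summable fun v => ‖lapl G f v‖ ^ 2 := by
  refine Summable.of_nonneg_of_le (fun v => by positivity) (fun v => ?_)
    ((summable_norm_sub_sq G hD hf).prod.mul_left (D : ℝ))
  dsimp only
  rw [tsum_adj_eq_sum G v fun u => ‖f v - f u‖ ^ 2]
  have h1 : ‖lapl G f v‖ ≤ ∑ u ∈ G.neighborFinset v, ‖f v - f u‖ := norm_sum_le _ _
  have h2 : (∑ u ∈ G.neighborFinset v, ‖f v - f u‖) ^ 2 ≤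
      (G.neighborFinset v).card * ∑ u ∈ G.neighborFinset v, ‖f v - f u‖ ^ 2 :=
    sq_sum_le_card_mul_sum_sq
  have h3 : ((G.neighborFinset v).card : ℝ) ≤ D := by exact_mod_cast hD v
  calc ‖lapl G f v‖ ^ 2 ≤ (∑ u ∈ G.neighborFinset v, ‖f v - f u‖) ^ 2 := by gcongr
    _ ≤ _ := h2
    _ ≤ _ := by gcongr

theorem summable_lapl_iterate {D : ℕ} (hD : ∀ v, G.degree v ≤ D) {f : V → ℂ}
    (hf : Summable fun v => ‖f v‖ ^ 2) (m : ℕ) :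
    Summable fun v => ‖(lapl G)^[m] f v‖ ^ 2 := by
  induction m with
  | zero => simpa using hf
  | succ m ih => simpa only [Function.iterate_succ_apply'] using summable_lapl G hD ih

/-- The Green formula for the graph Laplacian. -/
theorem two_mul_tsum_lapl_mul_conj {D : ℕ} (hD : ∀ v, G.degree v ≤ D) {f g : V → ℂ}
    (hf : Summable fun v => ‖f v‖ ^ 2) (hg : Summable fun v => ‖g v‖ ^ 2) :
    2 * ∑' v, lapl G f v * (starRingEnd ℂ) (g v) =
      ∑' p : V × V, if G.Adj p.1 p.2 then
        (f p.1 - f p.2) * (starRingEnd ℂ) (g p.1 - g p.2) else 0 := by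
  have hs : Summable fun p : V × V =>
      if G.Adj p.1 p.2 then (f p.1 - f p.2) * (starRingEnd ℂ) (g p.1) else 0 := by
    refine summable_of_adj_bound G hD (g := fun v => ‖f v‖ ^ 2 + ‖g v‖ ^ 2)
      (h := fun v => ‖f v‖ ^ 2)
      (fun v => by positivity) (hf.add hg) (fun v => by positivity) hf
      (fun p hp => if_neg hp) fun p => ?_
    split_ifs
    · exact norm_sub_mul_conj_le _ _ _
    · rw [norm_zero]; positivity
  have h1 : ∑' v, lapl G f v * (starRingEnd ℂ) (g v) = ∑' p : V × V,
      if G.Adj p.1 p.2 then (f p.1 - f p.2) * (starRingEnd ℂ) (g p.1) else 0 := by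
    rw [hs.tsum_prod]
    refine tsum_congr fun v => ?_
    rw [tsum_adj_eq_sum G v fun u => (f v - f u) * (starRingEnd ℂ) (g v), lapl, Finset.sum_mul]
  have hs' := (Equiv.prodComm V V).summable_iff.2 hs
  have h2 := (Equiv.prodComm V V).tsum_eq fun p : V × V =>
      if G.Adj p.1 p.2 then (f p.1 - f p.2) * (starRingEnd ℂ) (g p.1) else 0
  rw [two_mul, h1]
  nth_rewrite 2 [← h2]
  refine (hs.tsum_add hs').symm.trans ?_
  refine tsum_congr fun p => ?_
  simp only [Function.comp_apply, Equiv.prodComm_apply, Prod.fst_swap, Prod.snd_swap, G.adj_comm p.2 p.1, map_sub]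
  split_ifs
  · ring
  · simp

theorem tsum_lapl_mul_conj_comm {D : ℕ} (hD : ∀ v, G.degree v ≤ D) {f g : V → ℂ}
    (hf : Summable fun v => ‖f v‖ ^ 2) (hg : Summable fun v => ‖g v‖ ^ 2) :
    ∑' v, lapl G f v * (starRingEnd ℂ) (g v) = ∑' v, f v * (starRingEnd ℂ) (lapl G g v) := by
  have h1 := two_mul_tsum_lapl_mul_conj G hD hf hg
  have h2 := congrArg (starRingEnd ℂ) (two_mul_tsum_lapl_mul_conj G hD hg hf)
  rw [map_mul, Complex.conj_tsum, Complex.conj_tsum] at h2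
  have h3 : (starRingEnd ℂ) 2 = 2 := map_ofNat _ 2
  refine mul_left_cancel₀ (two_ne_zero (α := ℂ)) ?_
  rw [h1]
  rw [h3] at h2
  convert h2.symm using 2
  · ext p
    split_ifs
    · simp [mul_comm]
    · simp
  · refine tsum_congr fun v => ?_
    simp [mul_comm]

theorem tsum_lapl_iterate_mul_conj_comm {D : ℕ} (hD : ∀ v, G.degree v ≤ D) (m : ℕ)
    {f g : V → ℂ} (hf : Summable fun v => ‖f v‖ ^ 2) (hg : Summable fun v => ‖g v‖ ^ 2) :
    ∑' v, (lapl G)^[m] f v * (starRingEnd ℂ) (g v) =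
      ∑' v, f v * (starRingEnd ℂ) ((lapl G)^[m] g v) := by
  induction m generalizing g with
  | zero => rfl
  | succ m ih =>
    simp only [Function.iterate_succ_apply' (lapl G) m f, Function.iterate_succ_apply (lapl G) m g]
    rw [tsum_lapl_mul_conj_comm G hD (summable_lapl_iterate G hD hf m) hg,
      ih (summable_lapl G hD hg)]

theorem dirichletPow_add_self {D : ℕ} (hD : ∀ v, G.degree v ≤ D) (m : ℕ) {f : V → ℂ}
    (hf : Summable fun v => ‖f v‖ ^ 2) :
    dirichletPow G f (m + m) = ∑' v, ‖(lapl G)^[m] f v‖ ^ 2 := by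
  have h := tsum_lapl_iterate_mul_conj_comm G hD m (summable_lapl_iterate G hD hf m) hf
  simp only [dirichletPow, Function.iterate_add_apply]
  rw [h, ← Complex.ofReal_re (∑' v, ‖(lapl G)^[m] f v‖ ^ 2), Complex.ofReal_tsum]
  congr 1
  refine tsum_congr fun v => ?_
  rw [Complex.mul_conj, Complex.normSq_eq_norm_sq]

theorem re_tsum_mul_conj_le {f g : V → ℂ}
    (hf : Summable fun v => ‖f v‖ ^ 2) (hg : Summable fun v => ‖g v‖ ^ 2) :
    (∑' v, f v * (starRingEnd ℂ) (g v)).re ≤ l2norm f * l2norm g := by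
  have h := Real.summable_and_inner_le_Lp_mul_Lq_tsum_of_nonneg Real.HolderConjugate.two_two
    (f := fun v => ‖f v‖) (g := fun v => ‖g v‖) (fun v => norm_nonneg _) (fun v => norm_nonneg _)
    (by simpa using hf) (by simpa using hg)
  have hn : ∀ v, ‖f v * (starRingEnd ℂ) (g v)‖ = ‖f v‖ * ‖g v‖ := by simp
  have hs : Summable fun v => ‖f v * (starRingEnd ℂ) (g v)‖ := by simpa only [hn] using h.1
  refine (Complex.re_le_norm _).trans ((norm_tsum_le_tsum_norm hs).trans ?_)
  simpa only [hn, l2norm, Real.sqrt_eq_rpow, Real.rpow_two] using h.2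

theorem two_mul_dirichletPow_one {D : ℕ} (hD : ∀ v, G.degree v ≤ D) {f : V → ℂ}
    (hf : Summable fun v => ‖f v‖ ^ 2) :
    2 * dirichletPow G f 1 =
      ∑' p : V × V, if G.Adj p.1 p.2 then ‖f p.1 - f p.2‖ ^ 2 else 0 := by
  have h := congrArg Complex.re (two_mul_tsum_lapl_mul_conj G hD hf hf)
  have h2 : (2 * ∑' v, lapl G f v * (starRingEnd ℂ) (f v)).re = 2 * dirichletPow G f 1 := by
    simp [dirichletPow]
  rw [← h2, h, ← Complex.ofReal_re (∑' p : V × V, _), Complex.ofReal_tsum]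
  congr 1
  refine tsum_congr fun p => ?_
  split_ifs
  · rw [Complex.mul_conj, Complex.normSq_eq_norm_sq]
  · simp

open Classical in
theorem tsum_compl_le {D : ℕ} (hD : ∀ v, G.degree v ≤ D) {S : Set V} {K : ℕ}
    (hKS : ∀ v ∈ bdry G S, K ≤ {u | u ∈ S ∧ G.Adj v u}.ncard)
    (hcover : S ∪ bdry G S = Set.univ) {f : V → ℂ} (hf : Summable fun v => ‖f v‖ ^ 2) :
    K * ∑' v, (if v ∈ S then 0 else ‖f v‖ ^ 2) ≤
      4 * dirichletPow G f 1 + 2 * (D0 G S * ∑' v, if v ∈ S then ‖f v‖ ^ 2 else 0) := by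
  have hS : Summable fun v => if v ∈ S then ‖f v‖ ^ 2 else 0 :=
    Summable.of_nonneg_of_le (fun v => by split_ifs <;> positivity)
      (fun v => by split_ifs <;> simp) hf
  have hSc : Summable fun v => if v ∈ S then 0 else ‖f v‖ ^ 2 :=
    Summable.of_nonneg_of_le (fun v => by split_ifs <;> positivity)
      (fun v => by split_ifs <;> simp) hf
  have hE := summable_norm_sub_sq G hD hf
  -- The contributions of the edges joining the complement of `S` to `S`.
  have hA : Summable fun p : V × V =>
      if G.Adj p.1 p.2 then (if p.1 ∉ S ∧ p.2 ∈ S then ‖f p.1‖ ^ 2 else 0) else 0 :=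
    Summable.of_nonneg_of_le (fun p => by split_ifs <;> positivity)
      (fun p => by split_ifs <;> simp)
      (summable_adj_fst G hD (fun v => by positivity) hf)
  have hB : Summable fun p : V × V =>
      if G.Adj p.1 p.2 then (if p.1 ∉ S ∧ p.2 ∈ S then ‖f p.2‖ ^ 2 else 0) else 0 :=
    Summable.of_nonneg_of_le (fun p => by split_ifs <;> positivity)
      (fun p => by split_ifs <;> simp)
      (summable_adj_snd G hD (fun v => by positivity) hf)
  have hAB := hA.tsum_le_tsum (g := fun p : V × V =>
      2 * (if G.Adj p.1 p.2 then ‖f p.1 - f p.2‖ ^ 2 else 0) +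
      2 * (if G.Adj p.1 p.2 then (if p.1 ∉ S ∧ p.2 ∈ S then ‖f p.2‖ ^ 2 else 0) else 0))
    (fun p => by
      have h := norm_sub_sq_le (f p.1 - f p.2) (-f p.2)
      rw [sub_neg_eq_add, sub_add_cancel, norm_neg] at h
      split_ifs
      · exact h
      · positivity
      · simp) ((hE.mul_left 2).add (hB.mul_left 2))
  rw [(hE.mul_left 2).tsum_add (hB.mul_left 2), tsum_mul_left, tsum_mul_left,
    ← two_mul_dirichletPow_one G hD hf] at hAB
  have hlow : K * ∑' v, (if v ∈ S then 0 else ‖f v‖ ^ 2) ≤ ∑' p : V × V,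
      if G.Adj p.1 p.2 then (if p.1 ∉ S ∧ p.2 ∈ S then ‖f p.1‖ ^ 2 else 0) else 0 := by
    rw [hA.tsum_prod, ← tsum_mul_left]
    refine (hSc.mul_left _).tsum_le_tsum (fun v => ?_) hA.prod
    rw [tsum_adj_eq_sum G v fun u => if v ∉ S ∧ u ∈ S then ‖f v‖ ^ 2 else 0]
    by_cases hv : v ∈ S
    · simp [hv]
    · have hb : v ∈ bdry G S := by
        have := hcover.symm ▸ Set.mem_univ v
        exact this.resolve_left hv
      have hset : {u | u ∈ S ∧ G.Adj v u} = ↑((G.neighborFinset v).filter (· ∈ S)) := by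
        ext u; simp [and_comm]
      have hc := hKS v hb
      rw [hset, Set.ncard_coe_finset] at hc
      have hc' : (K : ℝ) ≤ ((G.neighborFinset v).filter (· ∈ S)).card := by exact_mod_cast hc
      simp only [hv, not_false_eq_true, true_and, if_false]
      rw [← Finset.sum_filter, Finset.sum_const, nsmul_eq_mul]
      gcongr
  have hup : ∑' p : V × V,
      (if G.Adj p.1 p.2 then (if p.1 ∉ S ∧ p.2 ∈ S then ‖f p.2‖ ^ 2 else 0) else 0) ≤
      D0 G S * ∑' v, if v ∈ S then ‖f v‖ ^ 2 else 0 := by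
    have hB' := (Equiv.prodComm V V).summable_iff.2 hB
    rw [← (Equiv.prodComm V V).tsum_eq, ← tsum_mul_left]
    refine hB'.tsum_prod.trans_le ?_
    refine hB'.prod.tsum_le_tsum (fun u => ?_) (hS.mul_left _)
    have hrow := tsum_adj_eq_sum G u fun v => if v ∉ S ∧ u ∈ S then ‖f u‖ ^ 2 else 0
    refine (le_of_eq (tsum_congr fun v => ?_)).trans (hrow.trans_le ?_)
    · exact if_congr (G.adj_comm v u) rfl rfl
    by_cases hu : u ∈ S
    · have hset : {w | w ∈ bdry G S ∧ G.Adj u w} = ↑((G.neighborFinset u).filter (· ∉ S)) := by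
        ext w
        simp only [bdry, Set.mem_ofPred_eq, Finset.coe_filter, SimpleGraph.mem_neighborFinset]
        exact ⟨fun h => ⟨h.2, h.1.1⟩, fun h => ⟨⟨h.2, u, hu, h.1⟩, h.1⟩⟩
      have hd := d0_le_D0 G hD S hu
      rw [d0, hset, Set.ncard_coe_finset] at hd
      have hd' : (((G.neighborFinset u).filter (· ∉ S)).card : ℝ) ≤ D0 G S := by exact_mod_cast hd
      simp only [hu, and_true, if_true]
      rw [← Finset.sum_filter, Finset.sum_const, nsmul_eq_mul]
      gcongr
    · simp [hu]
  linarith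

open Classical in
theorem l2norm_le_add_dirichletPow_one {D : ℕ} (hD : ∀ v, G.degree v ≤ D) {S : Set V} {K : ℕ}
    (hK : 1 ≤ K) (hKS : ∀ v ∈ bdry G S, K ≤ {u | u ∈ S ∧ G.Adj v u}.ncard)
    (hcover : S ∪ bdry G S = Set.univ) {f : V → ℂ} (hf : Summable fun v => ‖f v‖ ^ 2) :
    l2norm f ≤ Real.sqrt (2 * (D0 G S : ℝ) / K + 1) * Real.sqrt (∑' u : S, ‖f u‖ ^ 2) +
      2 / Real.sqrt K * Real.sqrt (dirichletPow G f 1) := by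
  have hKpos : (0 : ℝ) < K := by exact_mod_cast hK
  have hS : Summable fun v => if v ∈ S then ‖f v‖ ^ 2 else 0 :=
    Summable.of_nonneg_of_le (fun v => by split_ifs <;> positivity)
      (fun v => by split_ifs <;> simp) hf
  have hSc : Summable fun v => if v ∈ S then 0 else ‖f v‖ ^ 2 :=
    Summable.of_nonneg_of_le (fun v => by split_ifs <;> positivity)
      (fun v => by split_ifs <;> simp) hf
  have hsub : ∑' u : S, ‖f u‖ ^ 2 = ∑' v, if v ∈ S then ‖f v‖ ^ 2 else 0 := by
    rw [tsum_subtype S fun v => ‖f v‖ ^ 2]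
    rfl
  have hsplit : ∑' v, ‖f v‖ ^ 2 =
      ∑' v, (if v ∈ S then ‖f v‖ ^ 2 else 0) + ∑' v, (if v ∈ S then 0 else ‖f v‖ ^ 2) := by
    rw [← hS.tsum_add hSc]
    exact tsum_congr fun v => by split_ifs <;> simp
  have hmain := tsum_compl_le G hD hKS hcover hf
  have hdir : 0 ≤ dirichletPow G f 1 := by
    have h := two_mul_dirichletPow_one G hD hf
    have h' : 0 ≤ ∑' p : V × V, if G.Adj p.1 p.2 then ‖f p.1 - f p.2‖ ^ 2 else 0 :=
      tsum_nonneg fun p => by split_ifs <;> positivity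
    linarith
  rw [← hsub] at hmain hsplit
  set A := ∑' u : S, ‖f u‖ ^ 2
  have h2 : ∑' v, ‖f v‖ ^ 2 ≤ (2 * (D0 G S : ℝ) / K + 1) * A + 4 / K * dirichletPow G f 1 := by
    rw [hsplit]
    rw [mul_comm, ← le_div_iff₀ hKpos] at hmain
    refine (add_le_add_right hmain A).trans (le_of_eq ?_)
    field_simp
    ring
  have h4 : 2 / Real.sqrt K = Real.sqrt (4 / K) := by
    rw [Real.sqrt_div (by norm_num), show (4 : ℝ) = 2 ^ 2 by norm_num,
      Real.sqrt_sq (by norm_num)]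
  rw [h4, ← Real.sqrt_mul (by positivity), ← Real.sqrt_mul (by positivity), l2norm]
  have hA : 0 ≤ A := tsum_nonneg fun u => by positivity
  rw [Real.sqrt_le_left (by positivity), add_sq, Real.sq_sqrt (by positivity),
    Real.sq_sqrt (by positivity)]
  refine h2.trans ?_
  have := mul_nonneg (Real.sqrt_nonneg ((2 * (D0 G S : ℝ) / K + 1) * A))
    (Real.sqrt_nonneg (4 / K * dirichletPow G f 1))
  linarith

theorem l2norm_le_of_dirichletPow_one {D : ℕ} (hD : ∀ v, G.degree v ≤ D) {f : V → ℂ}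
    (hf : Summable fun v => ‖f v‖ ^ 2) {a c : ℝ} (hc : 0 ≤ c)
    (h : l2norm f ≤ a + c * Real.sqrt (dirichletPow G f 1)) (l : ℕ) :
    l2norm f ≤ 2 ^ l * a + c ^ 2 ^ l * Real.sqrt (dirichletPow G f (2 ^ l)) := by
  induction l with
  | zero => simpa using h
  | succ l ih =>
    set m := 2 ^ l
    have hpow : 2 ^ (l + 1) = m + m := by rw [pow_succ, mul_two]
    have hN : Real.sqrt (dirichletPow G f (m + m)) = l2norm ((lapl G)^[m] f) := by
      rw [dirichletPow_add_self G hD m hf, l2norm]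
    have hcs : dirichletPow G f m ≤ l2norm ((lapl G)^[m] f) * l2norm f :=
      re_tsum_mul_conj_le (summable_lapl_iterate G hD hf m) hf
    rw [hpow, hN]
    set N := l2norm ((lapl G)^[m] f)
    have hN0 : 0 ≤ N := Real.sqrt_nonneg _
    have hx0 : 0 ≤ l2norm f := Real.sqrt_nonneg _
    have hle : c ^ m * Real.sqrt (dirichletPow G f m) ≤ (l2norm f + c ^ (m + m) * N) / 2 := by
      refine (mul_le_mul_of_nonneg_left (Real.sqrt_le_sqrt hcs) (by positivity)).trans ?_
      refine abs_le_of_sq_le_sq' ?_ (by positivity) |>.2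
      rw [mul_pow, Real.sq_sqrt (by positivity), pow_add]
      nlinarith [sq_nonneg (l2norm f - c ^ m * c ^ m * N)]
    rw [pow_succ]
    linarith

end

theorem stmt7 [Countable V] (G : SimpleGraph V) [DecidableRel G.Adj] [G.LocallyFinite]
    (hconn : G.Connected) (D : ℕ) (hD : ∀ v, G.degree v ≤ D)
    (S : Set V) (K₀ : ℕ) (hK : 1 ≤ K₀)
    (hKS : ∀ v ∈ bdry G S, K₀ ≤ {u | u ∈ S ∧ G.Adj v u}.ncard)
    (hcover : S ∪ bdry G S = Set.univ)
    (l : ℕ) (hl : 1 ≤ l) (r : ℕ) (hr : r = 2 ^ l)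
    (f : V → ℂ) (hf : Memℓp f 2) :
    l2norm f ≤
      2 * (r : ℝ) * Real.sqrt (2 * (D0 G S : ℝ) / (K₀ : ℝ) + 1) *
        Real.sqrt (∑' u : S, ‖f u‖ ^ 2)
      + (2 : ℝ) ^ (4 * r - 3 : ℕ) / (K₀ : ℝ) ^ ((r : ℝ) / 2) *
        Real.sqrt (dirichletPow G f r) := by
  have hs : Summable fun v => ‖f v‖ ^ 2 := by
    simpa using hf.summable (by norm_num)
  have h := l2norm_le_of_dirichletPow_one G hD hs (by positivity)
    (l2norm_le_add_dirichletPow_one G hD hK hKS hcover hs) l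
  rw [← hr, show (2 : ℝ) ^ l = r by rw [hr]; push_cast; rfl] at h
  have hr2 : 2 ≤ r := hr ▸ (Nat.le_self_pow (by omega) 2)
  have hKr : Real.sqrt K₀ ^ r = (K₀ : ℝ) ^ ((r : ℝ) / 2) := by
    rw [Real.sqrt_eq_rpow, ← Real.rpow_natCast, ← Real.rpow_mul (by positivity)]
    congr 1
    ring
  rw [div_pow, hKr] at h
  refine h.trans (add_le_add ?_ ?_)
  · rw [← mul_assoc]
    gcongr
    have : (0 : ℝ) ≤ r := by positivity
    linarith
  · gcongr
    · norm_num
    · omega
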